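/- arXiv:1703.08540 — 2 statements merged into one kernel-verified Lean document; each statement's English description precedes it below -/
import Mathlib

section
/- Let G be a simple graph on a finite vertex set V with |V| = n, let C be an initial configuration, and let a quantum circuit with k+1 levels L_0, …, L_k with associated interactions I_0, …, I_k be given. Let d_I be the minimum total delay (number of swap cycles plus k+1 gate cycles) over all P2 solutions, and let d_O be the minimum delay over all P3 solutions. Then d_I − d_O ≤ k. -/
/-!
Nearest-neighbor optimization of quantum circuits on an arbitrary topology graph.

A topology graph is a simple graph `G` on a finite vertex set `V` with `|V| = n`.
Qubits are indexed by `Fin n` and a configuration is a bijection `Fin n ≃ V`.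
A swap layer (matching of `G`) is encoded as an involutive permutation of `V`
moving each non-fixed vertex to an adjacent vertex.
-/

/-- A swap layer: a matching of the topology graph `G`, encoded as an involutive
permutation of the vertices whose non-fixed points are swapped along edges of `G`. -/
structure SwapLayer {V : Type*} (G : SimpleGraph V) where
  perm : Equiv.Perm V
  invol : ∀ v, perm (perm v) = v
  adj_or_fixed : ∀ v, perm v = v ∨ G.Adj v (perm v)

/-- Applying a list of swap layers to a configuration, in order. -/
def applySwaps {V : Type*} {G : SimpleGraph V} {n : ℕ} (C : Fin n ≃ V)
    (Ms : List (SwapLayer G)) : Fin n ≃ V :=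
  Ms.foldl (fun c M => c.trans M.perm) C

/-- A quantum gate on `n` qubits, with a set of control qubits and a target qubit. -/
structure Gate (n : ℕ) where
  controls : Finset (Fin n)
  target : Fin n
  target_not_control : target ∉ controls

/-- The (nonempty) set of qubits a gate acts on. -/
def Gate.var {n : ℕ} (g : Gate n) : Finset (Fin n) := insert g.target g.controls

/-- A level: a finite set of gates acting on pairwise disjoint sets of qubits. -/
def IsLevel {n : ℕ} (L : Finset (Gate n)) : Prop :=
  (L : Set (Gate n)).Pairwise fun g h => Disjoint g.var h.var

/-- A configuration `c` satisfies the interaction of level `L` if for every gate of `L`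
every control qubit is placed adjacent to the target qubit. -/
def Satisfies {V : Type*} (G : SimpleGraph V) {n : ℕ} (c : Fin n ≃ V)
    (L : Finset (Gate n)) : Prop :=
  ∀ g ∈ L, ∀ q ∈ g.controls, G.Adj (c q) (c g.target)

/-- A P2 solution from initial configuration `C` for a circuit with `k+1` levels
`L 0, …, L k`: a sequence of swap layers together with monotone indices `t j`
such that after the first `t j` swap layers the configuration satisfies the
interaction of level `L j`. -/
structure P2Sol {V : Type*} (G : SimpleGraph V) {n : ℕ} (C : Fin n ≃ V) (k : ℕ)
    (L : Fin (k + 1) → Finset (Gate n)) where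
  swaps : List (SwapLayer G)
  t : Fin (k + 1) → ℕ
  mono : Monotone t
  t_le : ∀ j, t j ≤ swaps.length
  sat : ∀ j, Satisfies G (applySwaps C (swaps.take (t j))) (L j)

/-- Total delay of a P2 solution: swap cycles plus one cycle per level. -/
def P2Sol.totalDelay {V : Type*} {G : SimpleGraph V} {n : ℕ} {C : Fin n ≃ V} {k : ℕ}
    {L : Fin (k + 1) → Finset (Gate n)} (s : P2Sol G C k L) : ℕ :=
  s.swaps.length + (k + 1)

/-- A P3 solution from initial configuration `C` for a circuit with `k+1` levels:
a sequence of cycles, each consisting of a swap layer and at most one executed level.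
Levels are executed in order, each in exactly one cycle; a level may be executed in
a cycle only if the configuration at the start of that cycle satisfies its interaction
and the cycle's swap layer fixes every vertex occupied by a qubit acted on by the level. -/
structure P3Sol {V : Type*} (G : SimpleGraph V) {n : ℕ} (C : Fin n ≃ V) (k : ℕ)
    (L : Fin (k + 1) → Finset (Gate n)) where
  cycles : List (SwapLayer G × Option (Fin (k + 1)))
  exec_order : cycles.filterMap Prod.snd = List.finRange (k + 1)
  sat : ∀ i : Fin cycles.length, ∀ j, (cycles.get i).2 = some j →
    Satisfies G (applySwaps C ((cycles.take i).map Prod.fst)) (L j)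
  no_touch : ∀ i : Fin cycles.length, ∀ j, (cycles.get i).2 = some j →
    ∀ g ∈ L j, ∀ q ∈ g.var,
      (cycles.get i).1.perm (applySwaps C ((cycles.take i).map Prod.fst) q) =
        applySwaps C ((cycles.take i).map Prod.fst) q

/-- Delay of a P3 solution: its number of cycles. -/
def P3Sol.delay {V : Type*} {G : SimpleGraph V} {n : ℕ} {C : Fin n ≃ V} {k : ℕ}
    {L : Fin (k + 1) → Finset (Gate n)} (s : P3Sol G C k L) : ℕ :=
  s.cycles.length

/-- In a P3 solution each level is executed in some cycle, and these cycles can be chosen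
monotonically in the level. -/
theorem P3Sol.exists_monotone_cycle {V : Type*} {G : SimpleGraph V} {n : ℕ} {C : Fin n ≃ V}
    {k : ℕ} {L : Fin (k + 1) → Finset (Gate n)} (s : P3Sol G C k L) :
    ∃ t : Fin (k + 1) → Fin s.cycles.length,
      Monotone t ∧ ∀ j, (s.cycles.get (t j)).2 = some j := by
  have h_exec : ∀ j, ∃ i : Fin s.cycles.length, (s.cycles.get i).2 = some j := fun j => by
    have hj : j ∈ s.cycles.filterMap Prod.snd := s.exec_order ▸ List.mem_finRange j
    obtain ⟨a, ha, haj⟩ := List.mem_filterMap.1 hj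
    obtain ⟨i, rfl⟩ := List.mem_iff_get.1 ha
    exact ⟨i, haj⟩
  choose t ht using h_exec
  have h_sorted : (s.cycles.filterMap Prod.snd).Pairwise (· < ·) :=
    s.exec_order ▸ List.pairwise_lt_finRange (k + 1)
  rw [List.pairwise_filterMap, List.pairwise_iff_get] at h_sorted
  refine ⟨t, fun j j' hjj' => ?_, ht⟩
  by_contra! hlt
  exact (h_sorted _ _ hlt j' (ht j') j (ht j)).not_ge hjj'

/-- Every P3 solution yields a P2 solution of total delay larger by at most `k`: the swap layer
of the final cycle is not needed. -/
theorem P3Sol.exists_p2Sol_totalDelay_le {V : Type*} {G : SimpleGraph V} {n : ℕ}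
    {C : Fin n ≃ V} {k : ℕ} {L : Fin (k + 1) → Finset (Gate n)} (s : P3Sol G C k L) :
    ∃ s' : P2Sol G C k L, s'.totalDelay ≤ s.delay + k := by
  obtain ⟨t, htm, ht⟩ := s.exists_monotone_cycle
  have h_pos : 0 < s.cycles.length := (t 0).pos
  have h_le : ∀ j, (t j : ℕ) ≤ s.cycles.length - 1 := fun j => Nat.le_sub_one_of_lt (t j).2
  refine ⟨⟨(s.cycles.take (s.cycles.length - 1)).map Prod.fst, fun j => t j,
    fun _ _ h => htm h, fun j => ?_, fun j => ?_⟩, ?_⟩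
  · simpa using h_le j
  · rw [← List.map_take, List.take_take, min_eq_left (h_le j)]
    exact s.sat (t j) j (ht j)
  · simp only [P2Sol.totalDelay, P3Sol.delay, List.length_map, List.length_take]
    omega

/-- **Theorem (statement 0).** For a topology graph `G` on `n` vertices, an initial
configuration `C`, and a quantum circuit with `k+1` levels, the minimum total delay
`dI` over all P2 solutions and the minimum delay `dO` over all P3 solutions
satisfy `dI - dO ≤ k`. -/
theorem p2_optimal_delay_le_p3_optimal_delay_add_levels
    {V : Type*} [Fintype V] {n k : ℕ} (G : SimpleGraph V)
    (hcard : Fintype.card V = n) (C : Fin n ≃ V)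
    (L : Fin (k + 1) → Finset (Gate n)) (hL : ∀ j, IsLevel (L j))
    (dI dO : ℕ)
    (hI : IsLeast {d | ∃ s : P2Sol G C k L, s.totalDelay = d} dI)
    (hO : IsLeast {d | ∃ s : P3Sol G C k L, s.delay = d} dO) :
    dI - dO ≤ k := by
  obtain ⟨s, rfl⟩ := hO.1
  obtain ⟨s', hs'⟩ := s.exists_p2Sol_totalDelay_le
  have h_min : dI ≤ s'.totalDelay := hI.2 ⟨s', rfl⟩
  omega
end

section
/- Let G be a simple graph on a finite vertex set V with |V| = n, let C be an initial configuration, and let a quantum circuit with k+1 levels L_0, …, L_k with interactions I_0, …, I_k be given. From any P3 solution of delay d one can construct a P2 solution of total delay at most d + k: for each cycle in which a level is executed concurrently with a nonempty swap layer, split that cycle into a swap-only cycle followed by a gate-only cycle. Hence the minimum P2 total delay d_I satisfies d_I ≤ d + k for every P3 solution of delay d. -/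
theorem List.map_some_filterMap_sublist {α β : Type*} (f : α → Option β) (l : List α) :
    ((l.filterMap f).map some).Sublist (l.map f) := by
  induction l with
  | nil => simp
  | cons a l ih =>
    cases h : f a with
    | none => simpa [h] using ih.cons none
    | some b => simpa [h] using ih

/-- If the entries of `l` mapped by `f` to some index list `Fin m` in increasing order, then
the positions of these entries form a strictly increasing sequence. -/
theorem List.exists_strictMono_of_filterMap_eq_finRange {α : Type*} {m : ℕ}
    (f : α → Option (Fin m)) (l : List α) (h : l.filterMap f = List.finRange m) :
    ∃ p : Fin m → Fin l.length, StrictMono p ∧ ∀ j, f (l.get (p j)) = some j := by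
  have hs := List.map_some_filterMap_sublist f l
  rw [h, List.sublist_iff_exists_fin_orderEmbedding_get_eq] at hs
  obtain ⟨e, he⟩ := hs
  refine ⟨fun j => (e (j.cast (by simp))).cast (by simp), fun i j hij => ?_, fun j => ?_⟩
  · have : e (i.cast (by simp)) < e (j.cast (by simp)) := e.strictMono hij
    exact this
  · have := he (j.cast (by simp))
    simp at this
    simpa using this.symm

/-- A P3 solution yields a P2 solution by performing every swap layer except the last one,
separating the gates from the swaps. -/
theorem P3Sol.exists_p2Sol {V : Type*} {G : SimpleGraph V} {n k : ℕ} {C : Fin n ≃ V}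
    {L : Fin (k + 1) → Finset (Gate n)} (s : P3Sol G C k L) :
    ∃ s₂ : P2Sol G C k L, s₂.totalDelay = s.delay + k := by
  obtain ⟨p, hp, hexec⟩ :=
    List.exists_strictMono_of_filterMap_eq_finRange Prod.snd s.cycles s.exec_order
  have hle : ∀ j, (p j : ℕ) ≤ s.cycles.length - 1 := fun j => by have := (p j).isLt; omega
  refine ⟨{ swaps := (s.cycles.map Prod.fst).take (s.cycles.length - 1)
            t := fun j => p j
            mono := fun i j hij => hp.monotone hij
            t_le := fun j => by simpa using hle j
            sat := fun j => ?_ }, ?_⟩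
  · rw [List.take_take, min_eq_left (hle j), ← List.map_take]
    exact s.sat (p j) j (hexec j)
  · have := (p 0).isLt
    simp only [P2Sol.totalDelay, P3Sol.delay, List.length_take, List.length_map]
    omega

/-- **Theorem (statement 3).** From any P3 solution of delay `d` one can construct a
P2 solution of total delay at most `d + k`; hence the minimum P2 total delay `dI`
satisfies `dI ≤ d + k` for every P3 solution of delay `d`. -/
theorem p2_solution_from_p3_solution
    {V : Type*} [Fintype V] {n k : ℕ} (G : SimpleGraph V)
    (hcard : Fintype.card V = n) (C : Fin n ≃ V)
    (L : Fin (k + 1) → Finset (Gate n)) (hL : ∀ j, IsLevel (L j))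
    (dI : ℕ)
    (hI : IsLeast {d | ∃ s : P2Sol G C k L, s.totalDelay = d} dI) :
    ∀ s₃ : P3Sol G C k L,
      (∃ s₂ : P2Sol G C k L, s₂.totalDelay ≤ s₃.delay + k) ∧
        dI ≤ s₃.delay + k := by
  intro s₃
  obtain ⟨s₂, h⟩ := s₃.exists_p2Sol
  exact ⟨⟨s₂, h.le⟩, hI.2 ⟨s₂, h⟩⟩
end
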